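/- Let G be a finite simple graph with mad(G) < 14/5 and ch_3^d(G) > 7 such that every proper subgraph H of G (obtained from G by deleting at least one vertex or at least one edge) satisfies ch_3^d(H) ≤ 7. Then no vertex of degree 3 has all three of its neighbors in W_1(G). -/

import Mathlib

open SimpleGraph

/-- `φ` is a proper coloring of `G` that is 3-dynamic: every vertex `v` sees at least
`min 3 (deg v)` distinct colors on its neighborhood. -/
def IsDyn3Coloring {V : Type*} (G : SimpleGraph V) (φ : V → ℕ) : Prop :=
  (∀ u v, G.Adj u v → φ u ≠ φ v) ∧
  ∀ v, min 3 (G.neighborSet v).ncard ≤ (φ '' G.neighborSet v).ncard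

/-- `G` is 3-dynamically colorable from the list assignment `L`. -/
def Dyn3ListColorable {V : Type*} (G : SimpleGraph V) (L : V → Finset ℕ) : Prop :=
  ∃ φ : V → ℕ, IsDyn3Coloring G φ ∧ ∀ v, φ v ∈ L v

/-- `ch_3^d(G) ≤ k` : `G` is 3-dynamically `L`-colorable for every list assignment `L`
with `|L v| ≥ k` for all `v`. -/
def Ch3dLE {V : Type*} (G : SimpleGraph V) (k : ℕ) : Prop :=
  ∀ L : V → Finset ℕ, (∀ v, k ≤ (L v).card) → Dyn3ListColorable G L

/-- `mad(G) < c` : every nonempty subgraph has average degree `< c`. -/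
def MadLT {V : Type*} (G : SimpleGraph V) (c : ℚ) : Prop :=
  ∀ H : G.Subgraph, H.verts.Nonempty →
    (2 * H.edgeSet.ncard : ℚ) / (H.verts.ncard : ℚ) < c

/-- `mad(G) ≤ c` : every nonempty subgraph has average degree `≤ c`. -/
def MadLE {V : Type*} (G : SimpleGraph V) (c : ℚ) : Prop :=
  ∀ H : G.Subgraph, H.verts.Nonempty →
    (2 * H.edgeSet.ncard : ℚ) / (H.verts.ncard : ℚ) ≤ c

/-- Every proper subgraph of `G` (deleting at least one vertex or edge) has
`ch_3^d ≤ k`. -/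
def ProperSubgraphsCh3dLE {V : Type*} (G : SimpleGraph V) (k : ℕ) : Prop :=
  ∀ H : G.Subgraph, H ≠ ⊤ → Ch3dLE H.coe k

/-- `x ∈ W_i(G)` : `x` has degree 3 and exactly `i` neighbors of degree 2. -/
def Wmem {V : Type*} (G : SimpleGraph V) (i : ℕ) (x : V) : Prop :=
  (G.neighborSet x).ncard = 3 ∧
    {y | G.Adj x y ∧ (G.neighborSet y).ncard = 2}.ncard = i

/-- `y` is a weak neighbor of `x` : they are distinct and have a common neighbor of
degree 2. -/
def WeakAdj {V : Type*} (G : SimpleGraph V) (x y : V) : Prop :=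
  x ≠ y ∧ ∃ w, G.Adj x w ∧ G.Adj y w ∧ (G.neighborSet w).ncard = 2

open Classical in
/-- colored neighbors -/
noncomputable def cnb {V : Type*} [Fintype V] (G : SimpleGraph V) (T : Finset V) (v : V) :
    Finset V := Finset.univ.filter (fun w => G.Adj v w ∧ w ∈ T)

/-- good partial coloring -/
def GoodP {V : Type*} [Fintype V] (G : SimpleGraph V) (L : V → Finset ℕ) (T : Finset V)
    (φ : V → ℕ) : Prop :=
  (∀ u ∈ T, ∀ v ∈ T, G.Adj u v → φ u ≠ φ v) ∧
  (∀ v, min 3 (cnb G T v).card ≤ ((cnb G T v).image φ).card) ∧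
  ∀ v ∈ T, φ v ∈ L v

open Classical in
noncomputable def cst {V : Type*} [Fintype V] (G : SimpleGraph V) (T : Finset V) (w : V) : ℕ :=
  (if w ∈ T then 1 else 0) + (if (cnb G T w).card ≤ 2 then (cnb G T w).card else 0)

open Classical in
theorem ext_step {V : Type*} [Fintype V] (G : SimpleGraph V) (L : V → Finset ℕ)
    (hL : ∀ v, 7 ≤ (L v).card) (T : Finset V) (φ : V → ℕ) (h : GoodP G L T φ)
    (p : V) (hp : p ∉ T) (hc : ∑ w ∈ cnb G Finset.univ p, cst G T w ≤ 6) :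
    ∃ φ', GoodP G L (insert p T) φ' := by
  obtain ⟨h1, h2, h3⟩ := h
  let F : V → Finset ℕ := fun w => (if w ∈ T then {φ w} else ∅) ∪
    (if (cnb G T w).card ≤ 2 then (cnb G T w).image φ else ∅)
  have hF : ∀ w, (F w).card ≤ cst G T w := by
    intro w
    refine (Finset.card_union_le _ _).trans ?_
    unfold cst
    refine Nat.add_le_add ?_ ?_
    · split_ifs <;> simp
    · split_ifs
      · exact Finset.card_image_le
      · simp
  have hcard : ((cnb G Finset.univ p).biUnion F).card < (L p).card := by
    have := (Finset.card_biUnion_le (s := cnb G Finset.univ p) (t := F)).trans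
      (Finset.sum_le_sum (fun w _ => hF w))
    have := hL p
    omega
  obtain ⟨c, hcL, hcF⟩ := Finset.exists_mem_notMem_of_card_lt_card hcard
  have hcF' : ∀ w, G.Adj p w → c ∉ F w := by
    intro w hw hcw
    exact hcF (Finset.mem_biUnion.2 ⟨w, by simp [cnb, hw], hcw⟩)
  have hA : ∀ w ∈ T, G.Adj p w → φ w ≠ c := by
    intro w hw hpw e
    apply hcF' w hpw
    simp [F, hw, e]
  have hB : ∀ w, G.Adj p w → (cnb G T w).card ≤ 2 → c ∉ (cnb G T w).image φ := by
    intro w hw h2 hc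
    apply hcF' w hw
    simp only [F, Finset.mem_union]
    right
    rw [if_pos h2]; exact hc
  have hne : ∀ w ∈ T, w ≠ p := fun w hw e => hp (e ▸ hw)
  have himg : ∀ v, (cnb G T v).image (Function.update φ p c) = (cnb G T v).image φ := by
    intro v
    apply Finset.image_congr
    intro w hw
    have : w ∈ T := by
      have := Finset.mem_coe.1 hw
      simp [cnb] at this; exact this.2
    simp [Function.update_of_ne (hne w this)]
  refine ⟨Function.update φ p c, ?_, ?_, ?_⟩
  · intro u hu v hv huv
    rcases Finset.mem_insert.1 hu with rfl | hu
    · rcases Finset.mem_insert.1 hv with rfl | hv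
      · exact absurd huv (G.irrefl)
      · rw [Function.update_self, Function.update_of_ne (hne v hv)]
        exact (hA v hv huv).symm
    · rcases Finset.mem_insert.1 hv with hvp | hv
      · rw [hvp] at huv ⊢
        rw [Function.update_self, Function.update_of_ne (hne u (by assumption))]
        exact (hA u (by assumption) huv.symm)
      · rw [Function.update_of_ne (hne v hv), Function.update_of_ne (hne u hu)]
        exact h1 u hu v hv huv
  · intro v
    by_cases hv : G.Adj p v
    · have e : cnb G (insert p T) v = insert p (cnb G T v) := by
        ext w
        simp only [cnb, Finset.mem_filter, Finset.mem_univ, true_and, Finset.mem_insert]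
        constructor
        · tauto
        · rintro (rfl | h)
          · exact ⟨hv.symm, Or.inl rfl⟩
          · tauto
      have hpn : p ∉ cnb G T v := by simp [cnb, hp]
      rw [e, Finset.image_insert, himg, Function.update_self, Finset.card_insert_of_notMem hpn]
      have := h2 v
      by_cases hk : (cnb G T v).card ≤ 2
      · rw [Finset.card_insert_of_notMem (hB v hv hk)]
        omega
      · have := Finset.card_le_card (Finset.subset_insert c ((cnb G T v).image φ))
        omega
    · have e : cnb G (insert p T) v = cnb G T v := by
        ext w
        simp only [cnb, Finset.mem_filter, Finset.mem_univ, true_and, Finset.mem_insert]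
        constructor
        · rintro ⟨h, rfl | h'⟩
          · exact absurd h.symm hv
          · exact ⟨h, h'⟩
        · tauto
      rw [e, himg]; exact h2 v
  · intro v hv
    rcases Finset.mem_insert.1 hv with rfl | hv
    · rw [Function.update_self]; exact hcL
    · rw [Function.update_of_ne (hne v hv)]; exact h3 v hv

theorem cst_le_three {V : Type*} [Fintype V] (G : SimpleGraph V) (T : Finset V) (w : V) :
    cst G T w ≤ 3 := by
  unfold cst; split_ifs <;> omega

theorem cst_le {V : Type*} [Fintype V] (G : SimpleGraph V) (T : Finset V) (w : V) :
    cst G T w ≤ 1 + (cnb G T w).card := by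
  unfold cst; split_ifs <;> omega

theorem cst_le' {V : Type*} [Fintype V] (G : SimpleGraph V) (T : Finset V) (w : V) (h : w ∉ T) :
    cst G T w ≤ (cnb G T w).card := by
  unfold cst; split_ifs <;> omega

theorem cnb_lt {V : Type*} [Fintype V] (G : SimpleGraph V) (T : Finset V) (w a : V)
    (h : G.Adj w a) (ha : a ∉ T) :
    (cnb G T w).card + 1 ≤ (cnb G Finset.univ w).card := by
  classical
  have : insert a (cnb G T w) ⊆ cnb G Finset.univ w := by
    intro b hb
    rcases Finset.mem_insert.1 hb with rfl | hb
    · simp [cnb, h]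
    · simp [cnb] at hb ⊢; exact hb.1
  have h' := Finset.card_le_card this
  rwa [Finset.card_insert_of_notMem (by simp [cnb, ha])] at h'

theorem cnb_lt2 {V : Type*} [Fintype V] (G : SimpleGraph V) (T : Finset V) (w a b : V)
    (h : G.Adj w a) (ha : a ∉ T) (h' : G.Adj w b) (hb : b ∉ T) (hab : a ≠ b) :
    (cnb G T w).card + 2 ≤ (cnb G Finset.univ w).card := by
  classical
  have : insert b (insert a (cnb G T w)) ⊆ cnb G Finset.univ w := by
    intro c hc
    rcases Finset.mem_insert.1 hc with rfl | hc
    · simp [cnb, h']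
    rcases Finset.mem_insert.1 hc with rfl | hc
    · simp [cnb, h]
    · simp [cnb] at hc ⊢; exact hc.1
  have h' := Finset.card_le_card this
  rwa [Finset.card_insert_of_notMem (by simp [cnb, hb, hab.symm]),
    Finset.card_insert_of_notMem (by simp [cnb, ha])] at h'

theorem cnb_ncard {V : Type*} [Fintype V] (G : SimpleGraph V) (v : V) :
    (cnb G Finset.univ v).card = (G.neighborSet v).ncard := by
  rw [← Set.ncard_coe_finset]
  congr 1
  ext w; simp [cnb]

theorem step_z {V : Type*} [Fintype V] [DecidableEq V] (G : SimpleGraph V) (L : V → Finset ℕ)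
    (hL : ∀ v, 7 ≤ (L v).card) (T : Finset V) (h : ∃ φ, GoodP G L T φ)
    (z : V) (hz : (cnb G Finset.univ z).card = 2) :
    ∃ φ', GoodP G L (insert z T) φ' := by
  by_cases hT : z ∈ T
  · rwa [Finset.insert_eq_of_mem hT]
  obtain ⟨φ, h⟩ := h
  have := ext_step G L hL T φ h z hT (by
    refine (Finset.sum_le_card_nsmul _ _ 3 (fun w _ => cst_le_three G T w)).trans ?_
    simp [hz])
  convert this

theorem step_x {V : Type*} [Fintype V] [DecidableEq V] (G : SimpleGraph V) (L : V → Finset ℕ)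
    (hL : ∀ v, 7 ≤ (L v).card) (T : Finset V) (h : ∃ φ, GoodP G L T φ)
    (x : V) (hx : (cnb G Finset.univ x).card = 3) (hxT : x ∉ T)
    (hy : ∀ y, G.Adj x y → (cnb G Finset.univ y).card = 3 ∧ ∃ z, G.Adj y z ∧ z ∉ T ∧ z ≠ x) :
    ∃ φ', GoodP G L (insert x T) φ' := by
  obtain ⟨φ, h⟩ := h
  have := ext_step G L hL T φ h x hxT (by
    refine (Finset.sum_le_card_nsmul _ _ 2 (fun w hw => ?_)).trans ?_
    · have hw : G.Adj x w := by simpa [cnb] using hw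
      obtain ⟨h3, z, hz, hzT, hzx⟩ := hy w hw
      have := cnb_lt2 G T w x z hw.symm hxT hz hzT hzx.symm
      have := cst_le G T w
      omega
    · simp [hx])
  convert this

theorem step_y {V : Type*} [Fintype V] [DecidableEq V] (G : SimpleGraph V) (L : V → Finset ℕ)
    (hL : ∀ v, 7 ≤ (L v).card) (T : Finset V) (h : ∃ φ, GoodP G L T φ)
    (x y z : V) (hy : (cnb G Finset.univ y).card = 3) (hx : (cnb G Finset.univ x).card = 3)
    (hz : (cnb G Finset.univ z).card = 2) (hxT : x ∉ T) (hyT : y ∉ T) (hzT : z ∉ T)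
    (hxy : G.Adj y x) (hyz : G.Adj y z) :
    ∃ φ', GoodP G L (insert y T) φ' := by
  obtain ⟨φ, h⟩ := h
  have hxz : z ≠ x := by rintro rfl; omega
  have := ext_step G L hL T φ h y hyT (by
    have mx : x ∈ cnb G Finset.univ y := by simp [cnb, hxy]
    have mz : z ∈ (cnb G Finset.univ y).erase x := by simp [cnb, hyz, hxz]
    rw [← Finset.add_sum_erase _ _ mx, ← Finset.add_sum_erase _ _ mz]
    have hr := Finset.sum_le_card_nsmul (((cnb G Finset.univ y).erase x).erase z) (cst G T) 3
      (fun w _ => cst_le_three G T w)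
    rw [Finset.card_erase_of_mem mz, Finset.card_erase_of_mem mx, hy] at hr
    simp only [smul_eq_mul] at hr
    change ∑ w ∈ ((cnb G Finset.univ y).erase x).erase z, cst G T w ≤ _ at hr
    have a1 := cst_le' G T x hxT
    have a2 := cst_le' G T z hzT
    have a3 := cnb_lt G T x y hxy.symm hyT
    have a4 := cnb_lt G T z y hyz.symm hyT
    omega)
  convert this

theorem init_good {V : Type*} [Fintype V] (G : SimpleGraph V) (L : V → Finset ℕ)
    (hL : ∀ v, 7 ≤ (L v).card) (hmin : ProperSubgraphsCh3dLE G 7) (T : Finset V)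
    (x : V) (hxT : x ∉ T) (hT : ∀ v ∉ T, (cnb G T v).card ≤ 1) : ∃ φ, GoodP G L T φ := by
  classical
  let H : G.Subgraph := (⊤ : G.Subgraph).induce (T : Set V)
  have hH : H ≠ ⊤ := by
    intro e
    have : x ∈ H.verts := by rw [e]; trivial
    exact hxT (by simpa [H] using this)
  obtain ⟨ψ, ⟨p1, p2⟩, p3⟩ := hmin H hH (fun v => L v.1) (fun v => hL v.1)
  have hv : ∀ v, v ∈ T → v ∈ H.verts := fun v h => by simpa [H] using h
  let φ : V → ℕ := fun v => if h : v ∈ T then ψ ⟨v, hv v h⟩ else 0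
  have hφ : ∀ v (h : v ∈ T), φ v = ψ ⟨v, hv v h⟩ := fun v h => by simp [φ, h]
  refine ⟨φ, ?_, ?_, ?_⟩
  · intro u hu v hv' huv
    rw [hφ u hu, hφ v hv']
    apply p1
    simp [H, hu, hv', huv]
  · intro v
    by_cases hvT : v ∈ T
    · have key := p2 ⟨v, hv v hvT⟩
      have e1 : (Subtype.val '' (H.coe.neighborSet ⟨v, hv v hvT⟩)) = (cnb G T v : Set V) := by
        ext w
        simp only [Set.mem_image, cnb]
        constructor
        · rintro ⟨⟨w', hw'⟩, h, rfl⟩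
          simp [H] at h hw' ⊢
          tauto
        · intro h
          simp at h
          refine ⟨⟨w, hv w h.2⟩, ?_, rfl⟩
          simp [H, h, hvT]
      have e2 : (cnb G T v).card = (H.coe.neighborSet ⟨v, hv v hvT⟩).ncard := by
        rw [← Set.ncard_coe_finset, ← e1, Set.ncard_image_of_injective _ Subtype.val_injective]
      have e3 : ((cnb G T v).image φ).card = (ψ '' (H.coe.neighborSet ⟨v, hv v hvT⟩)).ncard := by
        rw [← Set.ncard_coe_finset, Finset.coe_image, ← e1, Set.image_image]
        congr 1
        apply Set.image_congr
        rintro ⟨w, hw⟩ _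
        exact hφ w (by simpa [H] using hw)
      rw [e2, e3]; exact key
    · have := hT v hvT
      rcases Finset.eq_empty_or_nonempty (cnb G T v) with h | h
      · simp [h]
      · have := (h.image φ).card_pos
        omega
  · intro v h
    rw [hφ v h]; exact p3 _

theorem min_counterexample7_no_three_W1_neighbors {V : Type*} [Fintype V]
    (G : SimpleGraph V) (hmad : MadLT G (14 / 5)) (hG : ¬ Ch3dLE G 7)
    (hmin : ProperSubgraphsCh3dLE G 7) :
    ∀ x : V, (G.neighborSet x).ncard = 3 →
      ¬ (∀ y : V, G.Adj x y → Wmem G 1 y) := by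
  classical
  intro x hx hW
  apply hG
  intro L hL
  have hz : ∀ y, ∃ z, G.Adj x y → G.Adj y z ∧ (cnb G Finset.univ z).card = 2 := by
    intro y
    by_cases h : G.Adj x y
    · obtain ⟨z, hz⟩ := Set.ncard_eq_one.1 (hW y h).2
      have : z ∈ {y_1 | G.Adj y y_1 ∧ (G.neighborSet y_1).ncard = 2} := by rw [hz]; rfl
      exact ⟨z, fun _ => ⟨this.1, by rw [cnb_ncard]; exact this.2⟩⟩
    · exact ⟨y, fun h' => absurd h' h⟩
  choose z hz using hz
  have hx3 : (cnb G Finset.univ x).card = 3 := by rw [cnb_ncard]; exact hx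
  have hy3 : ∀ y, G.Adj x y → (cnb G Finset.univ y).card = 3 := fun y h => by
    rw [cnb_ncard]; exact (hW y h).1
  obtain ⟨a, b, c, hab, hac, hbc, hN⟩ := Finset.card_eq_three.1 hx3
  have hadj : ∀ y, G.Adj x y ↔ y = a ∨ y = b ∨ y = c := by
    intro y
    have : y ∈ cnb G Finset.univ x ↔ y ∈ ({a, b, c} : Finset V) := by rw [hN]
    simpa [cnb] using this
  have ha : G.Adj x a := (hadj a).2 (by simp)
  have hb : G.Adj x b := (hadj b).2 (by simp)
  have hc : G.Adj x c := (hadj c).2 (by simp)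
  have hzx : ∀ y, G.Adj x y → z y ≠ x := by
    intro y hy e
    have := (hz y hy).2
    rw [e] at this; omega
  have hzy : ∀ y, G.Adj x y → ∀ y', G.Adj x y' → z y ≠ y' := by
    intro y hy y' hy' e
    have := (hz y hy).2
    rw [e, hy3 y' hy'] at this; omega
  have hyx : ∀ y, G.Adj x y → x ≠ y := fun y h => h.ne
  let T : Finset V := Finset.univ \ {x, a, b, c, z a, z b, z c}
  have hT : ∀ v, v ∉ T ↔ v = x ∨ v = a ∨ v = b ∨ v = c ∨ v = z a ∨ v = z b ∨ v = z c := by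
    intro v; simp [T]; tauto
  have g0 : ∃ φ, GoodP G L T φ := by
    have hxT : x ∉ T := (hT x).2 (by simp)
    have hyT : ∀ y, G.Adj x y → y ∉ T := fun y h => (hT y).2 (by
      have := (hadj y).1 h; tauto)
    have hzT : ∀ y, G.Adj x y → z y ∉ T := fun y h => (hT _).2 (by
      rcases (hadj y).1 h with rfl | rfl | rfl <;> simp)
    refine init_good G L hL hmin T x hxT ?_
    have Ay : ∀ y, G.Adj x y → (cnb G T y).card ≤ 1 := by
      intro y h
      have := cnb_lt2 G T y x (z y) h.symm hxT (hz y h).1 (hzT y h) (hzx y h).symm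
      have := hy3 y h
      omega
    have Az : ∀ y, G.Adj x y → (cnb G T (z y)).card ≤ 1 := by
      intro y h
      have := cnb_lt G T (z y) y (hz y h).1.symm (hyT y h)
      have := (hz y h).2
      omega
    intro v hv
    rcases (hT v).1 hv with rfl | rfl | rfl | rfl | rfl | rfl | rfl
    · have := cnb_lt2 G T v a b ha (hyT a ha) hb (hyT b hb) hab
      omega
    all_goals first | exact Ay _ ‹_› | exact Az _ ‹_›
  have n1 := hyx a ha
  have n2 := hyx b hb
  have n3 := hyx c hc
  have m1 := hzx a ha
  have m2 := hzx b hb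
  have m3 := hzx c hc
  have k := fun y hy => And.intro (hzy y hy a ha) (And.intro (hzy y hy b hb) (hzy y hy c hc))
  have k1 := k a ha
  have k2 := k b hb
  have k3 := k c hc
  have g1 := step_y G L hL _ g0 x a (z a) (hy3 a ha) hx3 (hz a ha).2
    (by simp [T]) (by simp [T]) (by simp [T]) ha.symm (hz a ha).1
  have g2 := step_y G L hL _ g1 x b (z b) (hy3 b hb) hx3 (hz b hb).2
    (by simp [T, n1]) (by simp [T, hab.symm]) (by simp [T, k2]) hb.symm (hz b hb).1
  have g3 := step_y G L hL _ g2 x c (z c) (hy3 c hc) hx3 (hz c hc).2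
    (by simp [T, n1, n2]) (by simp [T, hac.symm, hbc.symm]) (by simp [T, k3]) hc.symm (hz c hc).1
  have g4 := step_x G L hL _ g3 x hx3 (by simp [T, n1, n2, n3]) (by
    intro y hy
    refine ⟨hy3 y hy, z y, (hz y hy).1, ?_, hzx y hy⟩
    rcases (hadj y).1 hy with rfl | rfl | rfl
    · simp [T, k1]
    · simp [T, k2]
    · simp [T, k3])
  have g5 := step_z G L hL _ g4 (z a) (hz a ha).2
  have g6 := step_z G L hL _ g5 (z b) (hz b hb).2
  have g7 := step_z G L hL _ g6 (z c) (hz c hc).2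
  obtain ⟨φ, q1, q2, q3⟩ := g7
  have hall : insert (z c) (insert (z b) (insert (z a) (insert x (insert c (insert b
      (insert a T)))))) = Finset.univ := by
    ext v
    by_cases h : v ∈ T
    · simp [h]
    · have := (hT v).1 h
      simp only [Finset.mem_insert, Finset.mem_univ, iff_true]
      tauto
  rw [hall] at q1 q2 q3
  refine ⟨φ, ⟨fun u v h => q1 u (Finset.mem_univ _) v (Finset.mem_univ _) h, fun v => ?_⟩,
    fun v => q3 v (Finset.mem_univ _)⟩
  have := q2 v
  rw [cnb_ncard] at this
  convert this using 1
  rw [← Set.ncard_coe_finset, Finset.coe_image]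
  congr 2
  ext w; simp [cnb]
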